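/- Let A, G ⊆ ℕ with G ⟨A⟩-generic. Then the enumeration degree of G ⊕ A is a strong quasiminimal cover of the enumeration degree of A: deg_e(A) < deg_e(G ⊕ A), and every total enumeration degree c ≤ deg_e(G ⊕ A) satisfies c ≤ deg_e(A). -/

import Mathlib

open Classical

/-- The `e`-th computably enumerable subset of `ℕ` (the domain of the `e`-th
partial computable function). -/
def ceSet (e : ℕ) : Set ℕ :=
  {n | ((Denumerable.ofNat Nat.Partrec.Code e).eval n).Dom}

/-- The finite set canonically coded by `u` (via binary expansion). -/
def finCode (u : ℕ) : Set ℕ := {n | Nat.testBit u n}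

/-- The `i`-th enumeration operator applied to `B`. -/
def eOp (i : ℕ) (B : Set ℕ) : Set ℕ :=
  {n | ∃ u : ℕ, Nat.pair n u ∈ ceSet i ∧ finCode u ⊆ B}

/-- `A ≤ₑ B` via the index `i`. -/
def ELeVia (A B : Set ℕ) (i : ℕ) : Prop := A = eOp i B

/-- Enumeration reducibility. -/
def ELe (A B : Set ℕ) : Prop := ∃ i, ELeVia A B i

/-- `A ≡ₑ B` via the pair of indices `⟨i,j⟩`. -/
def EEquivVia (A B : Set ℕ) (i j : ℕ) : Prop := ELeVia A B i ∧ ELeVia B A j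

/-- Enumeration equivalence. -/
def EEquiv (A B : Set ℕ) : Prop := ELe A B ∧ ELe B A

/-- Strict enumeration reducibility. -/
def ELt (A B : Set ℕ) : Prop := ELe A B ∧ ¬ ELe B A

/-- The enumeration degree of `A`, i.e. its `≡ₑ`-class. -/
def edeg (A : Set ℕ) : Set (Set ℕ) := {B | EEquiv A B}

/-- `K_A = {⟨i,n⟩ : n ∈ Γ_i(A)}`. -/
def KSet (A : Set ℕ) : Set ℕ := {m | m.unpair.2 ∈ eOp m.unpair.1 A}

/-- The skip `A^⋄ = ℕ \ K_A`. -/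
def eSkip (A : Set ℕ) : Set ℕ := (KSet A)ᶜ

/-- `A ⊕ B = {2n : n ∈ A} ∪ {2n+1 : n ∈ B}`. -/
def eJoin (A B : Set ℕ) : Set ℕ :=
  {n | (∃ m ∈ A, n = 2 * m) ∨ (∃ m ∈ B, n = 2 * m + 1)}

/-- The enumeration jump `A' = K_A ⊕ (ℕ \ K_A)`. -/
def eJump (A : Set ℕ) : Set ℕ := eJoin (KSet A) (KSet A)ᶜ

/-- `u` is a uniformity function for `f` on the domain `D`. -/
def IsUniformityOn (D : Set (Set ℕ)) (f : Set ℕ → Set ℕ) (u : ℕ → ℕ) : Prop :=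
  ∀ A ∈ D, ∀ B ∈ D, ∀ i j : ℕ, EEquivVia A B i j →
    EEquivVia (f A) (f B) (u (Nat.pair i j)).unpair.1 (u (Nat.pair i j)).unpair.2

/-- `f` is uniformly e-invariant on the domain `D`. -/
def UniformlyEInvariantOn (D : Set (Set ℕ)) (f : Set ℕ → Set ℕ) : Prop :=
  ∃ u : ℕ → ℕ, IsUniformityOn D f u

/-- `f` is uniformly e-invariant. -/
def UniformlyEInvariant (f : Set ℕ → Set ℕ) : Prop :=
  UniformlyEInvariantOn Set.univ f

/-- `f` is e-invariant. -/
def EInvariant (f : Set ℕ → Set ℕ) : Prop :=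
  ∀ A B : Set ℕ, EEquiv A B → EEquiv (f A) (f B)

/-- `f ≤ₑ^▽ g`: `f` is e-below `g` on a cone. -/
def ConeLe (f g : Set ℕ → Set ℕ) : Prop :=
  ∃ D : Set ℕ, ∀ X : Set ℕ, ELe D X → ELe (f X) (g X)

/-- Borel functions on Cantor space `P(ℕ)`. -/
def BorelFun (F : Set ℕ → Set ℕ) : Prop := Measurable F

/-- A fixed computable coding of finite binary strings by natural numbers. -/
def strCode (σ : List Bool) : ℕ := Encodable.encode σ

/-- `σ` is an initial segment of (the characteristic sequence of) `G`. -/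
def InitSeg (σ : List Bool) (G : Set ℕ) : Prop :=
  ∀ i : Fin σ.length, (σ.get i = true ↔ (i : ℕ) ∈ G)

/-- `G` is `⟨A⟩`-generic: for every set `W` of binary strings with `W ≤ₑ A`,
some initial segment of `G` is in `W` or has no extension in `W`. -/
def AGeneric (A G : Set ℕ) : Prop :=
  ∀ W : Set (List Bool), ELe (strCode '' W) A →
    ∃ σ : List Bool, InitSeg σ G ∧ (σ ∈ W ∨ ∀ τ : List Bool, σ <+: τ → τ ∉ W)

/-- A set is total if its complement enumeration-reduces to it. -/
def TotalSet (A : Set ℕ) : Prop := ELe Aᶜ A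

/-! ### An enumeration calculus -/

theorem primrec_lbeq {α : Type} [Primcodable α] [BEq α] [LawfulBEq α] :
    Primrec₂ (fun a b : α => a == b) := by
  refine (Primrec.beq (α := α)).of_eq fun a b => ?_
  exact Bool.eq_iff_iff.2 (by simp)

/-- `P` is enumerable relative to positive information about `B`; the axioms are listed by a
primitive recursive function. -/
def EEn {α : Type} [Primcodable α] (B : Set ℕ) (P : α → Prop) : Prop :=
  ∃ f : α × ℕ → Option (List ℕ), Primrec f ∧
    ∀ a, P a ↔ ∃ k l, f (a, k) = some l ∧ ∀ x ∈ l, x ∈ B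

section calculus

variable {α β : Type} [Primcodable α] [Primcodable β] {B : Set ℕ}

theorem EEn.of_iff {P Q : α → Prop} (h : EEn B P) (e : ∀ a, Q a ↔ P a) : EEn B Q := by
  obtain ⟨f, hf, h⟩ := h
  exact ⟨f, hf, fun a => (e a).trans (h a)⟩

theorem EEn.prim {p : α → Bool} (hp : Primrec p) : EEn B (fun a => p a = true) := by
  refine ⟨fun q => cond (p q.1) (some []) none,
    Primrec.cond (hp.comp Primrec.fst) (Primrec.const _) (Primrec.const _), fun a => ?_⟩
  dsimp only
  cases p a <;> simp

theorem EEn.comp {P : β → Prop} (h : EEn B P) {g : α → β} (hg : Primrec g) :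
    EEn B (fun a => P (g a)) := by
  obtain ⟨f, hf, h⟩ := h
  exact ⟨fun q => f (g q.1, q.2),
    hf.comp (Primrec.pair (hg.comp Primrec.fst) Primrec.snd), fun a => h (g a)⟩

theorem EEn.and {P Q : α → Prop} (hP : EEn B P) (hQ : EEn B Q) :
    EEn B (fun a => P a ∧ Q a) := by
  obtain ⟨f, hf, hP⟩ := hP
  obtain ⟨g, hg, hQ⟩ := hQ
  refine ⟨fun q => (f (q.1, q.2.unpair.1)).bind fun l =>
    (g (q.1, q.2.unpair.2)).map fun m => l ++ m, ?_, fun a => ?_⟩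
  · refine Primrec.option_bind ?_ (Primrec.option_map ?_ ?_)
    · exact hf.comp (Primrec.pair Primrec.fst
        (Primrec.fst.comp (Primrec.unpair.comp Primrec.snd)))
    · exact hg.comp (Primrec.pair (Primrec.fst.comp Primrec.fst)
        (Primrec.snd.comp (Primrec.unpair.comp (Primrec.snd.comp Primrec.fst))))
    · exact Primrec.list_append.comp (Primrec.snd.comp Primrec.fst) Primrec.snd
  · dsimp only
    rw [hP, hQ]
    constructor
    · rintro ⟨⟨k, l, h1, h2⟩, k', l', h3, h4⟩
      refine ⟨Nat.pair k k', l ++ l', by simp [h1, h3], ?_⟩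
      intro x hx
      rcases List.mem_append.1 hx with hx | hx
      · exact h2 x hx
      · exact h4 x hx
    · rintro ⟨k, l, h1, h2⟩
      simp only [Option.bind_eq_some_iff, Option.map_eq_some_iff] at h1
      obtain ⟨l1, e1, l2, e2, rfl⟩ := h1
      exact ⟨⟨_, l1, e1, fun x hx => h2 x (by simp [hx])⟩,
        ⟨_, l2, e2, fun x hx => h2 x (by simp [hx])⟩⟩

theorem EEn.ex {P : α × β → Prop} (hP : EEn B P) : EEn B (fun a => ∃ b, P (a, b)) := by
  obtain ⟨f, hf, hP⟩ := hP
  refine ⟨fun q => (Encodable.decode (α := β) q.2.unpair.1).bind fun b =>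
    f ((q.1, b), q.2.unpair.2), ?_, fun a => ?_⟩
  · refine Primrec.option_bind ?_ ?_
    · exact Primrec.decode.comp (Primrec.fst.comp (Primrec.unpair.comp Primrec.snd))
    · exact hf.comp (Primrec.pair (Primrec.pair (Primrec.fst.comp Primrec.fst) Primrec.snd)
        (Primrec.snd.comp (Primrec.unpair.comp (Primrec.snd.comp Primrec.fst))))
  · constructor
    · rintro ⟨b, hb⟩
      obtain ⟨k, l, h1, h2⟩ := (hP _).1 hb
      exact ⟨Nat.pair (Encodable.encode b) k, l, by simp [h1], h2⟩
    · rintro ⟨k, l, h1, h2⟩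
      simp only [Option.bind_eq_some_iff] at h1
      obtain ⟨b, -, h1⟩ := h1
      exact ⟨b, (hP _).2 ⟨_, l, h1, h2⟩⟩

theorem foldr_opt (h : ℕ → Option (List ℕ)) (l : List ℕ) :
    (∃ t, l.foldr (fun x s => s.bind fun t => (h x).map fun m => m ++ t) (some []) = some t ∧
      ∀ y ∈ t, y ∈ B) ↔ ∀ x ∈ l, ∃ t, h x = some t ∧ ∀ y ∈ t, y ∈ B := by
  induction l with
  | nil => simp
  | cons a l ih =>
    rw [List.forall_mem_cons, ← ih]
    simp only [List.foldr_cons, Option.bind_eq_some_iff, Option.map_eq_some_iff]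
    constructor
    · rintro ⟨t, ⟨t1, e1, t2, e2, rfl⟩, h⟩
      exact ⟨⟨t2, e2, fun y hy => h y (by simp [hy])⟩, ⟨t1, e1, fun y hy => h y (by simp [hy])⟩⟩
    · rintro ⟨⟨t2, e2, h2⟩, ⟨t1, e1, h1⟩⟩
      refine ⟨t2 ++ t1, ⟨t1, e1, t2, e2, rfl⟩, ?_⟩
      intro y hy
      rcases List.mem_append.1 hy with hy | hy
      · exact h2 y hy
      · exact h1 y hy

theorem exists_choice_list (l : List ℕ) (w : ℕ → ℕ) : ∃ ks : List ℕ, ∀ x ∈ l, ks.getD x 0 = w x := by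
  refine ⟨(List.range (l.sum + 1)).map w, fun x hx => ?_⟩
  have : x ≤ l.sum := List.le_sum_of_mem hx
  have h2 : x < l.sum + 1 := by omega
  simp [List.getD_eq_getElem?_getD, h2]

theorem EEn.ball {Q : α × ℕ → Prop} (hQ : EEn B Q) {l : α → List ℕ} (hl : Primrec l) :
    EEn B (fun a => ∀ x ∈ l a, Q (a, x)) := by
  obtain ⟨f, hf, hQ⟩ := hQ
  refine ⟨fun q => (l q.1).foldr (fun x s => s.bind fun t =>
    (f ((q.1, x), (Denumerable.ofNat (List ℕ) q.2).getD x 0)).map fun m => m ++ t) (some []),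
    ?_, fun a => ?_⟩
  · refine Primrec.list_foldr (h := fun (q : α × ℕ) (p : ℕ × Option (List ℕ)) =>
      p.2.bind fun t => (f ((q.1, p.1), (Denumerable.ofNat (List ℕ) q.2).getD p.1 0)).map
        fun m => m ++ t) (hl.comp Primrec.fst) (Primrec.const _) ?_
    refine Primrec.option_bind (Primrec.snd.comp Primrec.snd) (Primrec.option_map ?_ ?_)
    · refine hf.comp (Primrec.pair (Primrec.pair ?_ ?_) ((Primrec.list_getD 0).comp ?_ ?_))
      · exact Primrec.fst.comp (Primrec.fst.comp Primrec.fst)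
      · exact Primrec.fst.comp (Primrec.snd.comp Primrec.fst)
      · exact (Primrec.ofNat _).comp (Primrec.snd.comp (Primrec.fst.comp Primrec.fst))
      · exact Primrec.fst.comp (Primrec.snd.comp Primrec.fst)
    · exact Primrec.list_append.comp Primrec.snd (Primrec.snd.comp Primrec.fst)
  · simp only [foldr_opt]
    constructor
    · intro h
      have h' : ∀ x, ∃ k, x ∈ l a → ∃ t, f ((a, x), k) = some t ∧ ∀ y ∈ t, y ∈ B := by
        intro x
        by_cases hx : x ∈ l a
        · obtain ⟨k, t, h1⟩ := (hQ _).1 (h x hx)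
          exact ⟨k, fun _ => ⟨t, h1⟩⟩
        · exact ⟨0, fun h => absurd h hx⟩
      choose w hw using h'
      obtain ⟨ks, hks⟩ := exists_choice_list (l a) w
      refine ⟨Encodable.encode ks, fun x hx => ?_⟩
      rw [Denumerable.ofNat_encode, hks x hx]
      exact hw x hx
    · rintro ⟨k, h⟩ x hx
      exact (hQ _).2 ⟨_, h x hx⟩

theorem EEn.use_sat {f : α × ℕ → Option (List ℕ)} (hf : Primrec f) {Q : β × ℕ → Prop}
    (hQ : EEn B Q) :
    EEn B (fun p : β × α => ∃ k l, f (p.2, k) = some l ∧ ∀ x ∈ l, Q (p.1, x)) := by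
  have h1 : EEn B (fun q : (β × α) × (ℕ × List ℕ) =>
      (f (q.1.2, q.2.1) == some q.2.2) = true) := by
    refine EEn.prim (primrec_lbeq.comp (hf.comp (Primrec.pair ?_ ?_)) (Primrec.option_some.comp ?_))
    · exact Primrec.snd.comp Primrec.fst
    · exact Primrec.fst.comp Primrec.snd
    · exact Primrec.snd.comp Primrec.snd
  have h2 : EEn B (fun q : (β × α) × (ℕ × List ℕ) => ∀ x ∈ q.2.2, Q (q.1.1, x)) :=
    EEn.ball (Q := fun r : ((β × α) × (ℕ × List ℕ)) × ℕ => Q (r.1.1.1, r.2))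
      (hQ.comp (Primrec.pair (Primrec.fst.comp (Primrec.fst.comp Primrec.fst)) Primrec.snd))
      (Primrec.snd.comp Primrec.snd)
  refine (h1.and h2).ex.of_iff fun p => ?_
  constructor
  · rintro ⟨k, l, h, h'⟩
    exact ⟨(k, l), by simpa using h, h'⟩
  · rintro ⟨⟨k, l⟩, h, h'⟩
    exact ⟨k, l, by simpa using h, h'⟩

theorem EEn.mem : EEn B (fun n : ℕ => n ∈ B) :=
  ⟨fun q => some [q.1], Primrec.option_some.comp
    (Primrec.list_cons.comp Primrec.fst (Primrec.const [])), fun a => by simp⟩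

theorem EEn.trans {D : Set ℕ} {P : α → Prop} (hP : EEn D P) (hD : EEn B (fun n => n ∈ D)) :
    EEn B P := by
  obtain ⟨f, hf, hP⟩ := hP
  exact ((EEn.use_sat hf (hD.comp (α := Unit × ℕ) Primrec.snd)).comp
    (g := fun a => ((), a)) (Primrec.pair (Primrec.const _) Primrec.id)).of_iff hP

end calculus

theorem primrec_testBit : Primrec₂ Nat.testBit := by
  have hp : Primrec₂ ((· ^ ·) : ℕ → ℕ → ℕ) := Primrec₂.unpaired'.1 Nat.Primrec.pow
  refine (primrec_lbeq.comp (Primrec.nat_mod.comp (Primrec.nat_div.comp Primrec.fst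
    (hp.comp (Primrec.const 2) Primrec.snd)) (Primrec.const 2)) (Primrec.const 1)).of_eq ?_
  rintro ⟨u, x⟩
  simp only [Nat.testBit_eq_decide_div_mod_eq]
  exact Bool.eq_iff_iff.2 (by simp)

/-- The list of the elements of `finCode u`. -/
def bitList (u : ℕ) : List ℕ :=
  (List.range u).filterMap fun x => cond (u.testBit x) (some x) none

theorem primrec_bitList : Primrec bitList :=
  Primrec.listFilterMap Primrec.list_range
    (Primrec.cond (primrec_testBit.comp Primrec.fst Primrec.snd)
      (Primrec.option_some.comp Primrec.snd) (Primrec.const none))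

theorem mem_bitList {u x : ℕ} : x ∈ bitList u ↔ x ∈ finCode u := by
  have : u.testBit x = true → x < u := fun h =>
    lt_of_lt_of_le Nat.lt_two_pow_self (Nat.ge_two_pow_of_testBit h)
  simp only [bitList, finCode, List.mem_filterMap, List.mem_range, Set.mem_ofPred_eq]
  constructor
  · rintro ⟨y, -, h⟩
    cases hy : u.testBit y <;> simp [hy] at h
    exact h ▸ hy
  · intro h
    exact ⟨x, this h, by simp [h]⟩

theorem exists_finCode (l : List ℕ) : ∃ u, ∀ x, x ∈ finCode u ↔ x ∈ l := by
  induction l with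
  | nil => exact ⟨0, fun x => by simp [finCode]⟩
  | cons a l ih =>
    obtain ⟨u, hu⟩ := ih
    refine ⟨u ||| 2 ^ a, fun x => ?_⟩
    have := hu x
    simp only [finCode, Set.mem_ofPred_eq] at this
    simp only [finCode, Set.mem_ofPred_eq, Nat.testBit_or, Nat.testBit_two_pow, Bool.or_eq_true,
      this, List.mem_cons, decide_eq_true_eq]
    rw [or_comm, eq_comm]

theorem ELe.een {X B : Set ℕ} (h : ELe X B) : EEn B (fun n => n ∈ X) := by
  obtain ⟨i, rfl⟩ := h
  set c := Denumerable.ofNat Nat.Partrec.Code i with hc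
  refine ⟨fun q => cond (Nat.Partrec.Code.evaln q.2.unpair.1 c
    (Nat.pair q.1 q.2.unpair.2)).isSome (some (bitList q.2.unpair.2)) none, ?_, fun n => ?_⟩
  · have hu : Primrec fun q : ℕ × ℕ => q.2.unpair.2 :=
      Primrec.snd.comp (Primrec.unpair.comp Primrec.snd)
    have hk : Primrec fun q : ℕ × ℕ => q.2.unpair.1 :=
      Primrec.fst.comp (Primrec.unpair.comp Primrec.snd)
    refine Primrec.cond (Primrec.option_isSome.comp ?_)
      (Primrec.option_some.comp (primrec_bitList.comp hu)) (Primrec.const none)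
    exact Nat.Partrec.Code.primrec_evaln.comp (Primrec.pair (Primrec.pair hk (Primrec.const c))
      (Primrec₂.natPair.comp Primrec.fst hu))
  · constructor
    · rintro ⟨u, h1, h2⟩
      obtain ⟨y, hy⟩ := Part.dom_iff_mem.1 h1
      obtain ⟨k, hk⟩ := Nat.Partrec.Code.evaln_complete.1 hy
      refine ⟨Nat.pair k u, bitList u, ?_, fun x hx => h2 (mem_bitList.1 hx)⟩
      have : Nat.Partrec.Code.evaln k c (Nat.pair n u) = some y := hk
      simp [this]
    · rintro ⟨k, l, h1, h2⟩
      cases hs : (Nat.Partrec.Code.evaln k.unpair.1 c (Nat.pair n k.unpair.2)) with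
      | none => simp [hs] at h1
      | some y =>
        simp [hs] at h1
        subst h1
        refine ⟨k.unpair.2, ?_, fun x hx => h2 x (mem_bitList.2 hx)⟩
        exact Part.dom_iff_mem.2 ⟨y, Nat.Partrec.Code.evaln_complete.2 ⟨_, hs⟩⟩

theorem EEn.ele {X B : Set ℕ} (h : EEn B (fun n => n ∈ X)) : ELe X B := by
  obtain ⟨f, hf, hX⟩ := h
  -- list of rules whose use is covered by `u`
  let g : ℕ → ℕ → Option ℕ := fun m k => (f (m.unpair.1, k)).bind fun l =>
    cond (l.foldr (fun x s => m.unpair.2.testBit x && s) true) (some 0) none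
  have hg : Primrec₂ g := by
    refine Primrec.option_bind ?_ (Primrec.cond ?_ (Primrec.const _) (Primrec.const _))
    · exact hf.comp (Primrec.pair (Primrec.fst.comp (Primrec.unpair.comp Primrec.fst)) Primrec.snd)
    · refine Primrec.list_foldr (h := fun (q : (ℕ × ℕ) × List ℕ) (p : ℕ × Bool) =>
        q.1.1.unpair.2.testBit p.1 && p.2) Primrec.snd (Primrec.const true) ?_
      refine Primrec.and.comp (primrec_testBit.comp ?_ (Primrec.fst.comp Primrec.snd))
        (Primrec.snd.comp Primrec.snd)
      exact Primrec.snd.comp (Primrec.unpair.comp (Primrec.fst.comp (Primrec.fst.comp Primrec.fst)))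
  have hall : ∀ (u : ℕ) (l : List ℕ),
      l.foldr (fun x s => u.testBit x && s) true = true ↔ ∀ x ∈ l, x ∈ finCode u := by
    intro u l
    induction l with
    | nil => simp
    | cons a l ih => simp [ih, finCode]
  have hgm : ∀ m, (∃ k y, y ∈ g m k) ↔
      ∃ k l, f (m.unpair.1, k) = some l ∧ ∀ x ∈ l, x ∈ finCode m.unpair.2 := by
    intro m
    refine exists_congr fun k => ?_
    constructor
    · rintro ⟨y, hy⟩
      simp only [g, Option.mem_def, Option.bind_eq_some_iff] at hy
      obtain ⟨l, h1, h2⟩ := hy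
      refine ⟨l, h1, (hall _ _).1 ?_⟩
      by_contra h3
      rw [Bool.not_eq_true] at h3
      rw [h3] at h2
      simp at h2
    · rintro ⟨l, h1, h2⟩
      refine ⟨0, ?_⟩
      simp only [g, Option.mem_def, h1, Option.bind_some, (hall _ _).2 h2, cond_true]
  have hpart : Nat.Partrec fun m => Nat.rfindOpt (g m) :=
    Partrec.nat_iff.1 (Partrec.rfindOpt hg.to_comp)
  obtain ⟨c, hc⟩ := Nat.Partrec.Code.exists_code.1 hpart
  refine ⟨Encodable.encode c, ?_⟩
  ext n
  refine (hX n).trans ?_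
  simp only [eOp, ceSet, Denumerable.ofNat_encode, Set.mem_ofPred_eq, hc, Nat.rfindOpt_dom, hgm,
    Nat.unpair_pair]
  constructor
  · rintro ⟨k, l, h1, h2⟩
    obtain ⟨u, hu⟩ := exists_finCode l
    exact ⟨u, ⟨k, l, h1, fun x hx => (hu x).2 hx⟩, fun x hx => h2 x ((hu x).1 hx)⟩
  · rintro ⟨u, ⟨k, l, h1, h2⟩, h3⟩
    exact ⟨k, l, h1, fun x hx => h3 (h2 x hx)⟩

/-- Genericity phrased with the calculus. -/
theorem AGeneric.apply {A G : Set ℕ} (hG : AGeneric A G) {P : List Bool → Prop} (hP : EEn A P) :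
    ∃ σ : List Bool, InitSeg σ G ∧ (P σ ∨ ∀ τ : List Bool, σ <+: τ → ¬ P τ) := by
  refine hG {σ | P σ} (EEn.ele ?_)
  have h1 : EEn A (fun q : ℕ × List Bool => (Encodable.encode q.2 == q.1) = true) :=
    EEn.prim (primrec_lbeq.comp (Primrec.encode.comp Primrec.snd) Primrec.fst)
  refine ((hP.comp Primrec.snd).and h1).ex.of_iff fun n => ?_
  simp [strCode]

theorem initSeg_iff {σ : List Bool} {G : Set ℕ} :
    InitSeg σ G ↔ ∀ i b, σ[i]? = some b → (b = true ↔ i ∈ G) := by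
  constructor
  · intro h i b hb
    obtain ⟨hi, e⟩ := List.getElem?_eq_some_iff.1 hb
    have := h ⟨i, hi⟩
    simpa [e] using this
  · rintro h ⟨i, hi⟩
    exact h i _ (by simp [hi])

/-- The string of length `n` given by a set. -/
noncomputable def charStr (S : Set ℕ) (n : ℕ) : List Bool := (List.range n).map fun i => decide (i ∈ S)

theorem charStr_get (S : Set ℕ) (n i : ℕ) :
    (charStr S n)[i]? = if i < n then some (decide (i ∈ S)) else none := by
  unfold charStr
  split_ifs with h
  · simp [h]
  · simp [h]

theorem initSeg_charStr (S : Set ℕ) (n : ℕ) : InitSeg (charStr S n) S := by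
  rw [initSeg_iff]
  intro i b h
  rw [charStr_get] at h
  split_ifs at h
  simp at h
  simp [← h]

theorem charStr_extends {σ : List Bool} {S : Set ℕ} (h : InitSeg σ S) {n : ℕ}
    (hn : σ.length ≤ n) : σ <+: charStr S n := by
  have : σ = (charStr S n).take σ.length := by
    apply List.ext_getElem?
    intro i
    rw [List.getElem?_take, charStr_get]
    split_ifs with h1 h2
    · have h3 := initSeg_iff.1 h i _ (List.getElem?_eq_getElem h1)
      rw [List.getElem?_eq_getElem h1]
      congr 1
      exact Bool.eq_iff_iff.2 (by simpa using h3)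
    · omega
    · simpa using h1
  exact List.prefix_iff_eq_take.2 this

theorem eJoin_even {S A : Set ℕ} {x : ℕ} (h : x % 2 = 0) : x ∈ eJoin S A ↔ x / 2 ∈ S := by
  constructor
  · rintro (⟨m, hm, rfl⟩ | ⟨m, hm, rfl⟩)
    · simpa using hm
    · omega
  · intro hx
    exact Or.inl ⟨x / 2, hx, by omega⟩

theorem eJoin_odd {S A : Set ℕ} {x : ℕ} (h : ¬ x % 2 = 0) : x ∈ eJoin S A ↔ x / 2 ∈ A := by
  constructor
  · rintro (⟨m, hm, rfl⟩ | ⟨m, hm, rfl⟩)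
    · omega
    · have : (2 * m + 1) / 2 = m := by omega
      rwa [this]
  · intro hx
    exact Or.inr ⟨x / 2, hx, by omega⟩

/-- The positive part of a string. -/
def posBits (σ : List Bool) : Set ℕ := {i | σ[i]? = some true}

theorem posPart_sub {σ : List Bool} {G : Set ℕ} (h : InitSeg σ G) : posBits σ ⊆ G :=
  fun i hi => (initSeg_iff.1 h i true hi).1 rfl

theorem eJoin_mono {S S' A : Set ℕ} (h : S ⊆ S') : eJoin S A ⊆ eJoin S' A := by
  rintro x (⟨m, hm, rfl⟩ | ⟨m, hm, rfl⟩)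
  · exact Or.inl ⟨m, h hm, rfl⟩
  · exact Or.inr ⟨m, hm, rfl⟩

theorem een_join (A : Set ℕ) :
    EEn A (fun q : List Bool × ℕ => q.2 ∈ eJoin (posBits q.1) A) := by
  refine ⟨fun q => cond (q.1.2 % 2 == 0) (cond (q.1.1[q.1.2 / 2]? == some true) (some []) none)
    (some [q.1.2 / 2]), ?_, ?_⟩
  · have h2 : Primrec fun q : (List Bool × ℕ) × ℕ => q.1.2 := Primrec.snd.comp Primrec.fst
    have hd : Primrec fun q : (List Bool × ℕ) × ℕ => q.1.2 / 2 :=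
      Primrec.nat_div.comp h2 (Primrec.const 2)
    refine Primrec.cond (primrec_lbeq.comp (Primrec.nat_mod.comp h2 (Primrec.const 2))
      (Primrec.const 0)) (Primrec.cond (primrec_lbeq.comp ?_ (Primrec.const _)) (Primrec.const _)
      (Primrec.const _)) ?_
    · exact Primrec.list_getElem?.comp (Primrec.fst.comp Primrec.fst) hd
    · exact Primrec.option_some.comp (Primrec.list_cons.comp hd (Primrec.const []))
  · rintro ⟨σ, x⟩
    dsimp only
    by_cases hx : x % 2 = 0
    · rw [eJoin_even hx]
      have : (x % 2 == 0) = true := by simp [hx]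
      simp only [this, cond_true, posBits, Set.mem_ofPred_eq]
      by_cases h : σ[x / 2]? = some true
      · simp [h]
      · have h' : (σ[x / 2]? == some true) = false := by simpa using h
        simp [h, h']
    · rw [eJoin_odd hx]
      have : (x % 2 == 0) = false := by simpa using hx
      simp [this]

theorem een_right (G A : Set ℕ) : EEn (eJoin G A) (fun n => n ∈ A) := by
  refine ((EEn.mem (B := eJoin G A)).comp (g := fun n => 2 * n + 1) ?_).of_iff fun n => ?_
  · exact Primrec.succ.comp (Primrec.nat_mul.comp (Primrec.const 2) Primrec.id)
  · rw [eJoin_odd (by omega)]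
    have : (2 * n + 1) / 2 = n := by omega
    rw [this]

theorem een_left (G A : Set ℕ) : EEn (eJoin G A) (fun n => n ∈ G) := by
  refine ((EEn.mem (B := eJoin G A)).comp (g := fun n => 2 * n) ?_).of_iff fun n => ?_
  · exact Primrec.nat_mul.comp (Primrec.const 2) Primrec.id
  · rw [eJoin_even (by omega)]
    have : (2 * n) / 2 = n := by omega
    rw [this]

theorem generic_infinite {A G : Set ℕ} (hG : AGeneric A G) (m : ℕ) : ∃ n, m ≤ n ∧ n ∈ G := by
  have h1 : EEn A (fun q : List Bool × ℕ => (q.1[m + q.2]? == some true) = true) :=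
    EEn.prim (primrec_lbeq.comp (Primrec.list_getElem?.comp Primrec.fst
      (Primrec.nat_add.comp (Primrec.const m) Primrec.snd)) (Primrec.const _))
  obtain ⟨σ, hσ, h | h⟩ := hG.apply h1.ex
  · obtain ⟨n, hn⟩ := h
    exact ⟨m + n, by omega, posPart_sub hσ (by simpa [posBits] using hn)⟩
  · exfalso
    refine h (σ ++ List.replicate (m + 1) true) (List.prefix_append _ _) ⟨σ.length, ?_⟩
    rw [List.getElem?_append_right (by omega)]
    simp

theorem generic_not_ele {A G : Set ℕ} (hG : AGeneric A G) (h : EEn A (fun n => n ∈ G)) :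
    False := by
  have h1 : EEn A (fun q : List Bool × ℕ => (q.1[q.2]? == some false) = true) :=
    EEn.prim (primrec_lbeq.comp (Primrec.list_getElem?.comp Primrec.fst Primrec.snd)
      (Primrec.const _))
  obtain ⟨σ, hσ, h | h⟩ := hG.apply (h1.and (h.comp Primrec.snd)).ex
  · obtain ⟨n, h2, h3⟩ := h
    have := (initSeg_iff.1 hσ n false (by simpa using h2)).2 h3
    simp at this
  · obtain ⟨n, hn, hnG⟩ := generic_infinite hG σ.length
    refine h (σ ++ List.replicate (n + 1) false) (List.prefix_append _ _) ⟨n, ?_, hnG⟩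
    rw [List.getElem?_append_right hn]
    simp

theorem total_below {A G T : Set ℕ} (hG : AGeneric A G) (hT : EEn (eJoin G A) (fun n => n ∈ T))
    (hTc : EEn (eJoin G A) (fun n => n ∈ Tᶜ)) : EEn A (fun n => n ∈ T) := by
  obtain ⟨f, hf, hT⟩ := hT
  obtain ⟨g, hg, hTc⟩ := hTc
  have hF := EEn.use_sat hf (een_join A)
  have hH := EEn.use_sat hg (een_join A)
  -- if a rule is satisfied by `G ⊕ A`, it is satisfied by a long enough initial segment
  have use : ∀ l : List ℕ, (∀ x ∈ l, x ∈ eJoin G A) → ∀ n, l.sum < n →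
      ∀ x ∈ l, x ∈ eJoin (posBits (charStr G n)) A := by
    intro l hl n hn x hx
    have hle : x ≤ l.sum := List.le_sum_of_mem hx
    have hxG := hl x hx
    by_cases h2 : x % 2 = 0
    · rw [eJoin_even h2] at hxG ⊢
      have : x / 2 < n := by omega
      simp [posBits, charStr_get, this, hxG]
    · rw [eJoin_odd h2] at hxG ⊢
      exact hxG
  obtain ⟨σ, hσ, h | h⟩ := hG.apply (hF.and hH).ex
  · exfalso
    obtain ⟨n, ⟨k, l, h1, h2⟩, k', l', h3, h4⟩ := h
    exact (hTc n).2 ⟨k', l', h3, fun x hx => eJoin_mono (posPart_sub hσ) (h4 x hx)⟩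
      ((hT n).2 ⟨k, l, h1, fun x hx => eJoin_mono (posPart_sub hσ) (h2 x hx)⟩)
  · have hpre : EEn A (fun q : ℕ × List Bool => (q.2.take σ.length == σ) = true) :=
      EEn.prim (primrec_lbeq.comp (Primrec.list_take.comp (Primrec.const _) Primrec.snd)
        (Primrec.const _))
    refine (hpre.and (hF.comp (g := fun q : ℕ × List Bool => (q.2, q.1))
      (Primrec.pair Primrec.snd Primrec.fst))).ex.of_iff fun n => ?_
    constructor
    · intro hn
      obtain ⟨k, l, h1, h2⟩ := (hT n).1 hn
      refine ⟨charStr G (σ.length + l.sum + 1), ?_, k, l, h1, use l h2 _ (by omega)⟩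
      have := List.prefix_iff_eq_take.1
        (charStr_extends hσ (n := σ.length + l.sum + 1) (by omega))
      simpa using this.symm
    · rintro ⟨τ, h1, k, l, h2, h3⟩
      by_contra hn
      obtain ⟨k', l', h4, h5⟩ := (hTc n).1 hn
      have hτ : τ.take σ.length = σ := by simpa using h1
      have hmono : ∀ N, posBits (charStr G N) ⊆ posBits (charStr (posBits τ ∪ G) N) := by
        intro N i hi
        simp only [posBits, charStr_get, Set.mem_ofPred_eq] at hi ⊢
        split_ifs at hi ⊢
        simp at hi
        simp [hi]
      have hpσ : InitSeg σ (posBits τ ∪ G) := by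
        rw [initSeg_iff]
        intro i b hb
        rw [initSeg_iff.1 hσ i b hb]
        refine ⟨Or.inr, ?_⟩
        rintro (hi | hi)
        · have hlen : i < σ.length := (List.getElem?_eq_some_iff.1 hb).1
          have : σ[i]? = some true := by
            rw [← hτ, List.getElem?_take, if_pos hlen]
            exact hi
          exact (initSeg_iff.1 hσ i true this).1 rfl
        · exact hi
      have hτm : posBits τ ⊆
          posBits (charStr (posBits τ ∪ G) (σ.length + τ.length + l'.sum + 1)) := by
        intro i hi
        have hlen : i < τ.length := (List.getElem?_eq_some_iff.1 hi).1
        have h' : i < σ.length + τ.length + l'.sum + 1 := by omega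
        show (charStr (posBits τ ∪ G) _)[i]? = some true
        rw [charStr_get, if_pos h']
        simp [hi]
      refine h (charStr (posBits τ ∪ G) (σ.length + τ.length + l'.sum + 1))
        (charStr_extends hpσ (by omega)) ⟨n, ⟨k, l, h2, fun x hx => ?_⟩, k', l', h4, fun x hx => ?_⟩
      · exact eJoin_mono hτm (h3 x hx)
      · exact eJoin_mono (hmono _) (use l' h5 _ (by omega) x hx)

/-- **(essentially Medvedev)** If `G` is `⟨A⟩`-generic, then `G ⊕ A` is a
strong quasiminimal cover of `A`: `A <ₑ G ⊕ A`, and every set of total degree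
that is `≤ₑ G ⊕ A` is already `≤ₑ A`. -/
theorem generic_strong_quasiminimal_cover (A G : Set ℕ) (hG : AGeneric A G) :
    ELt A (eJoin G A) ∧
    ∀ C : Set ℕ, (∃ T : Set ℕ, EEquiv C T ∧ TotalSet T) →
      ELe C (eJoin G A) → ELe C A := by
  refine ⟨⟨(een_right G A).ele, fun h => generic_not_ele hG ((een_left G A).trans h.een)⟩, ?_⟩
  rintro C ⟨T, ⟨hCT, hTC⟩, hT⟩ hC
  have h1 : EEn (eJoin G A) (fun n => n ∈ T) := hTC.een.trans hC.een
  have h2 : EEn (eJoin G A) (fun n => n ∈ Tᶜ) := (ELe.een hT).trans h1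
  exact (hCT.een.trans (total_below hG h1 h2)).ele
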